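/- Under the protocol, for every node j and every t ≥ 1, |x_j(t) − x_j(t−1)| ≤ (1/2) W(0) / t^β, where W(0) = max_k x_k(0) − min_k x_k(0). -/

import Mathlib

open scoped Classical

noncomputable section

/-- The rounding function `R` sending `x` to `1`, `0`, `-1` according to `x > 1`,
`-1 ≤ x ≤ 1`, `x < -1`. -/
def Rq (y : ℝ) : ℝ := if y > 1 then 1 else if y < -1 then -1 else 0

/-- The data and evolution equations of the ternary-message average-consensus protocol
on `n` nodes.  `E t i j` means the edge `(i,j)` is present in the graph `G(t)`
(for `t ≥ 1`); `x t i` is the value of node `i` at time `t`; `xin t i j` is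
`x̂_{i,j,in}(t)`, `xout t i j` is `x̂_{i,j,out}(t)` and `q t i j` is `q_{i→j}(t)`. -/
structure Protocol (n : ℕ) where
  α : ℝ
  β : ℝ
  hα : 0 < α
  hαβ : α < β
  hβ : β < 1
  E : ℕ → Fin n → Fin n → Prop
  Esymm : ∀ t i j, E t i j → E t j i
  Eirrefl : ∀ t i, ¬ E t i i
  D : Fin n → Fin n → ℕ → ℝ
  Dsymm : ∀ i j t, D i j t = D j i t
  Dbound : ∀ t i j, E t i j →
    ((max (Set.ncard {k | E t i k}) (Set.ncard {k | E t j k}) : ℕ) : ℝ) ≤ D i j t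
  x : ℕ → Fin n → ℝ
  xin : ℕ → Fin n → Fin n → ℝ
  xout : ℕ → Fin n → Fin n → ℝ
  q : ℕ → Fin n → Fin n → ℝ
  hxin0 : ∀ i j, xin 0 i j = 0
  hxout0 : ∀ i j, xout 0 i j = 0
  hq : ∀ t, 1 ≤ t → ∀ i j, E t i j →
    q t i j = Rq ((t : ℝ) ^ α * (x (t - 1) i - xout (t - 1) i j))
  hxoutE : ∀ t, 1 ≤ t → ∀ i j, E t i j →
    xout t i j = xout (t - 1) i j + q t i j / (t : ℝ) ^ α
  hxinE : ∀ t, 1 ≤ t → ∀ i j, E t i j →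
    xin t i j = xin (t - 1) i j + q t j i / (t : ℝ) ^ α
  hxoutN : ∀ t, 1 ≤ t → ∀ i j, ¬ E t i j → xout t i j = xout (t - 1) i j
  hxinN : ∀ t, 1 ≤ t → ∀ i j, ¬ E t i j → xin t i j = xin (t - 1) i j
  hx : ∀ t, 1 ≤ t → ∀ i, x t i = x (t - 1) i + (1 / (t : ℝ) ^ β) *
    ∑ j ∈ Finset.univ.filter (fun j => E t i j ∧
        4 / (t : ℝ) ^ α < |xin t i j - xout t i j| ∧ q t j i = 0 ∧ q t i j = 0),
      (xin t i j - xout t i j) / (4 * D i j t)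

namespace Protocol

variable {n : ℕ} (P : Protocol n)

/-- The set `S(i,t)` of neighbors that node `i` includes in its update at time `t`. -/
def S (t : ℕ) (i : Fin n) : Finset (Fin n) :=
  Finset.univ.filter (fun j => P.E t i j ∧
    4 / (t : ℝ) ^ P.α < |P.xin t i j - P.xout t i j| ∧ P.q t j i = 0 ∧ P.q t i j = 0)

/-- The graph sequence of the protocol is `B`-core-connected with core edge
relation `Einf`: every core edge appears at some time, the graph of core edges is
connected, and every core edge appears in every time window `[kB+1, (k+1)B]`. -/
def CoreConnected (B : ℕ) (Einf : Fin n → Fin n → Prop) : Prop :=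
  (∀ i j, Einf i j → ∃ t, 1 ≤ t ∧ P.E t i j) ∧
  (SimpleGraph.fromRel Einf).Connected ∧
  ∀ k : ℕ, ∀ i j, Einf i j → ∃ t, k * B + 1 ≤ t ∧ t ≤ (k + 1) * B ∧ P.E t i j

end Protocol

/-- `M(x)`: the largest coordinate. -/
def maxV {n : ℕ} (y : Fin n → ℝ) : ℝ := ⨆ i, y i

/-- `m(x)`: the smallest coordinate. -/
def minV {n : ℕ} (y : Fin n → ℝ) : ℝ := ⨅ i, y i

/-- `W(x) = M(x) - m(x)`. -/
def Wsp {n : ℕ} (y : Fin n → ℝ) : ℝ := maxV y - minV y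

/-- The sup norm `‖x‖_∞ = max_i |x_i|`. -/
def normInf {n : ℕ} (y : Fin n → ℝ) : ℝ := ⨆ i, |y i|

/-- `V2(x) = sqrt(Σ_i (x_i - (1/n) Σ_j x_j)²)`. -/
def V2 {n : ℕ} (y : Fin n → ℝ) : ℝ :=
  Real.sqrt (∑ i, (y i - (∑ j, y j) / n) ^ 2)

theorem abs_le_one_of_Rq_eq_zero {y : ℝ} (h : Rq y = 0) : |y| ≤ 1 := by
  unfold Rq at h
  split_ifs at h with h₁ h₂
  · norm_num at h
  · norm_num at h
  · exact abs_le.2 ⟨not_lt.1 h₂, not_lt.1 h₁⟩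

/-- A sum of terms `a k / (4 D k)` with `a k ≤ 2 c`, over an index set with at most `D k`
elements, is at most `c / 2`. -/
theorem sum_div_four_mul_le {ι : Type*} (s : Finset ι) (a D : ι → ℝ) {c : ℝ} (hc : 0 ≤ c)
    (ha : ∀ k ∈ s, a k ≤ 2 * c) (hD : ∀ k ∈ s, (s.card : ℝ) ≤ D k) :
    ∑ k ∈ s, a k / (4 * D k) ≤ c / 2 := by
  rcases s.eq_empty_or_nonempty with rfl | hs
  · rw [Finset.sum_empty]
    positivity
  have hcard : (0 : ℝ) < s.card := by exact_mod_cast hs.card_pos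
  have hterm : ∀ k ∈ s, a k / (4 * D k) ≤ 2 * c / (4 * s.card) := fun k hk ↦
    div_le_div₀ (by positivity) (ha k hk) (by positivity) (by linarith [hD k hk])
  refine (Finset.sum_le_card_nsmul s _ _ hterm).trans (le_of_eq ?_)
  rw [nsmul_eq_mul]
  field_simp
  ring

namespace Protocol

variable {n : ℕ} (P : Protocol n)

theorem xin_eq_xout_swap (t : ℕ) (i k : Fin n) : P.xin t i k = P.xout t k i := by
  induction t with
  | zero => rw [P.hxin0, P.hxout0]
  | succ t ih =>
    have ht : 1 ≤ t + 1 := Nat.le_add_left 1 t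
    by_cases h : P.E (t + 1) i k
    · rw [P.hxinE _ ht _ _ h, P.hxoutE _ ht _ _ (P.Esymm _ _ _ h), Nat.add_sub_cancel, ih]
    · rw [P.hxinN _ ht _ _ h, P.hxoutN _ ht _ _ (fun h' ↦ h (P.Esymm _ _ _ h')),
        Nat.add_sub_cancel, ih]

/-- A silent endpoint's value is within `1 / t ^ α` of its estimate. -/
theorem abs_sub_xout_le {t : ℕ} (ht : 1 ≤ t) {i k : Fin n} (hE : P.E t i k)
    (hq : P.q t i k = 0) : |P.x (t - 1) i - P.xout t i k| ≤ 1 / (t : ℝ) ^ P.α := by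
  have hpos : 0 < (t : ℝ) ^ P.α := Real.rpow_pos_of_pos (by exact_mod_cast ht) _
  have h := abs_le_one_of_Rq_eq_zero ((P.hq t ht i k hE).symm.trans hq)
  rw [P.hxoutE t ht i k hE, hq, zero_div, add_zero, le_div_iff₀ hpos]
  rwa [abs_mul, abs_of_pos hpos, mul_comm] at h

theorem card_S_le_D {t : ℕ} {i k : Fin n} (hE : P.E t i k) :
    ((P.S t i).card : ℝ) ≤ P.D i k t := by
  refine le_trans ?_ (P.Dbound t i k hE)
  rw [Nat.cast_le, ← Set.ncard_coe_finset]
  refine le_max_of_le_left (Set.ncard_le_ncard (fun l hl ↦ ?_) (Set.toFinite _))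
  exact (Finset.mem_filter.1 hl).2.1

/-- The estimated difference along a used edge lies between `0` and twice the true one. -/
theorem estimate_sub_mem_Icc {t : ℕ} (ht : 1 ≤ t) {i k : Fin n} (hk : k ∈ P.S t i) {m M : ℝ}
    (hx : ∀ l, P.x (t - 1) l ∈ Set.Icc m M) :
    P.xin t i k - P.xout t i k ∈
      Set.Icc (2 * (m - P.x (t - 1) i)) (2 * (M - P.x (t - 1) i)) := by
  obtain ⟨-, hE, hgap, hqk, hqi⟩ := Finset.mem_filter.1 hk
  have h₁ := abs_le.1 (P.abs_sub_xout_le ht hE hqi)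
  have h₂ := abs_le.1 (P.abs_sub_xout_le ht (P.Esymm _ _ _ hE) hqk)
  rw [← P.xin_eq_xout_swap] at h₂
  have h4 : 4 / (t : ℝ) ^ P.α = 4 * (1 / (t : ℝ) ^ P.α) := by ring
  have hpos : 0 < 1 / (t : ℝ) ^ P.α :=
    one_div_pos.2 (Real.rpow_pos_of_pos (by exact_mod_cast ht) _)
  rw [h4] at hgap
  have hi := hx i
  have hk' := hx k
  simp only [Set.mem_Icc] at hi hk' ⊢
  rcases lt_abs.1 hgap with h | h <;> constructor <;> linarith

/-- If all values at time `t - 1` lie in `[m, M]`, the unscaled increment of node `i` moves it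
at most halfway towards either endpoint. -/
theorem sum_S_mem_Icc {t : ℕ} (ht : 1 ≤ t) (i : Fin n) {m M : ℝ}
    (hx : ∀ l, P.x (t - 1) l ∈ Set.Icc m M) :
    ∑ k ∈ P.S t i, (P.xin t i k - P.xout t i k) / (4 * P.D i k t) ∈
      Set.Icc ((m - P.x (t - 1) i) / 2) ((M - P.x (t - 1) i) / 2) := by
  have hD : ∀ k ∈ P.S t i, ((P.S t i).card : ℝ) ≤ P.D i k t := fun k hk ↦
    P.card_S_le_D (Finset.mem_filter.1 hk).2.1
  constructor
  · have h := sum_div_four_mul_le (P.S t i) (fun k ↦ -(P.xin t i k - P.xout t i k))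
      (fun k ↦ P.D i k t) (sub_nonneg.2 (hx i).1)
      (fun k hk ↦ by linarith [(P.estimate_sub_mem_Icc ht hk hx).1]) hD
    simp only [neg_div, Finset.sum_neg_distrib] at h
    linarith
  · exact sum_div_four_mul_le _ _ (fun k ↦ P.D i k t) (sub_nonneg.2 (hx i).2)
      (fun k hk ↦ (P.estimate_sub_mem_Icc ht hk hx).2) hD

theorem x_eq_add_sum_S {t : ℕ} (ht : 1 ≤ t) (i : Fin n) :
    P.x t i = P.x (t - 1) i + (1 / (t : ℝ) ^ P.β) *
      ∑ k ∈ P.S t i, (P.xin t i k - P.xout t i k) / (4 * P.D i k t) :=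
  P.hx t ht i

theorem x_mem_Icc {m M : ℝ} (h0 : ∀ i, P.x 0 i ∈ Set.Icc m M) (t : ℕ) (i : Fin n) :
    P.x t i ∈ Set.Icc m M := by
  induction t generalizing i with
  | zero => exact h0 i
  | succ t ih =>
    have ht : 1 ≤ t + 1 := Nat.le_add_left 1 t
    have hone : (1 : ℝ) ≤ ((t + 1 : ℕ) : ℝ) ^ P.β :=
      Real.one_le_rpow (by exact_mod_cast ht) (P.hα.trans P.hαβ).le
    have hw1 : 1 / ((t + 1 : ℕ) : ℝ) ^ P.β ≤ 1 := (div_le_one (by linarith)).2 hone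
    have hw0 : 0 ≤ 1 / ((t + 1 : ℕ) : ℝ) ^ P.β := by positivity
    obtain ⟨hlo, hhi⟩ := P.sum_S_mem_Icc ht i (m := m) (M := M) ih
    rw [P.x_eq_add_sum_S ht i]
    simp only [Nat.add_sub_cancel] at hlo hhi ⊢
    obtain ⟨hm, hM⟩ := ih i
    constructor
    · nlinarith [mul_le_mul_of_nonneg_left hlo hw0]
    · nlinarith [mul_le_mul_of_nonneg_left hhi hw0]

end Protocol

/-- `|x_j(t) - x_j(t-1)| ≤ (1/2) W(0) / t^β`. -/
theorem stmt8_increment_bound {n : ℕ} (hn : 1 ≤ n) (P : Protocol n)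
    (j : Fin n) (t : ℕ) (ht : 1 ≤ t) :
    |P.x t j - P.x (t - 1) j| ≤ (1 / 2) * Wsp (P.x 0) / (t : ℝ) ^ P.β := by
  have h0 : ∀ i, P.x 0 i ∈ Set.Icc (minV (P.x 0)) (maxV (P.x 0)) := fun i ↦
    ⟨ciInf_le (Set.finite_range _).bddBelow i, le_ciSup (Set.finite_range _).bddAbove i⟩
  have hpos : 0 < (t : ℝ) ^ P.β := Real.rpow_pos_of_pos (by exact_mod_cast ht) _
  obtain ⟨hlo, hhi⟩ := P.sum_S_mem_Icc ht j (P.x_mem_Icc h0 (t - 1))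
  obtain ⟨hm, hM⟩ := P.x_mem_Icc h0 (t - 1) j
  rw [P.x_eq_add_sum_S ht j, add_sub_cancel_left, abs_mul, abs_of_pos (one_div_pos.2 hpos),
    one_div_mul_eq_div]
  refine div_le_div_of_nonneg_right (abs_le.2 ?_) hpos.le
  unfold Wsp
  constructor <;> linarith
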